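/- Fix θ with 0 < θ ≤ α, where α = artanh(√2 − 1). Let G_θ(x) (resp. G*_θ(x)) denote the number of pairs (a,b) of positive integers of opposite parity in H_θ(x) (resp. H*_θ(x)), and let g_θ(x) (resp. g*_θ(x)) denote the number of such pairs that are additionally coprime. Then as x → ∞: G_θ(x) ∼ θ·x²/4, G*_θ(x) ∼ θ·x²/4, g_θ(x) ∼ 2θ·x²/π², and g*_θ(x) ∼ 2θ·x²/π². -/

import Mathlib

open Filter Real

/-- The number of integral, opposite-parity lattice points in the hyperbolic sector
`H_θ(x) = {(a,b) ∈ ℝ²_{>0} : a² - b² < x², b ≤ tanh(θ)·a}`. -/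
noncomputable def Gcount (θ x : ℝ) : ℕ :=
  {p : ℕ × ℕ | 0 < p.1 ∧ 0 < p.2 ∧ p.1 % 2 ≠ p.2 % 2 ∧
    (p.1 : ℝ) ^ 2 - (p.2 : ℝ) ^ 2 < x ^ 2 ∧ (p.2 : ℝ) ≤ Real.tanh θ * p.1}.ncard

/-- The number of integral, opposite-parity lattice points in the hyperbolic sector
`H*_θ(x) = {(a,b) ∈ ℝ²_{>0} : 2ab < x², b < a ≤ e^(2θ)·b}`. -/
noncomputable def GstarCount (θ x : ℝ) : ℕ :=
  {p : ℕ × ℕ | 0 < p.1 ∧ 0 < p.2 ∧ p.1 % 2 ≠ p.2 % 2 ∧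
    2 * (p.1 : ℝ) * (p.2 : ℝ) < x ^ 2 ∧ (p.2 : ℝ) < p.1 ∧
    (p.1 : ℝ) ≤ Real.exp (2 * θ) * p.2}.ncard

/-- The number of integral, coprime, opposite-parity lattice points in `H_θ(x)`. -/
noncomputable def gcount (θ x : ℝ) : ℕ :=
  {p : ℕ × ℕ | 0 < p.1 ∧ 0 < p.2 ∧ Nat.Coprime p.1 p.2 ∧ p.1 % 2 ≠ p.2 % 2 ∧
    (p.1 : ℝ) ^ 2 - (p.2 : ℝ) ^ 2 < x ^ 2 ∧ (p.2 : ℝ) ≤ Real.tanh θ * p.1}.ncard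

/-- The number of integral, coprime, opposite-parity lattice points in `H*_θ(x)`. -/
noncomputable def gstarCount (θ x : ℝ) : ℕ :=
  {p : ℕ × ℕ | 0 < p.1 ∧ 0 < p.2 ∧ Nat.Coprime p.1 p.2 ∧ p.1 % 2 ≠ p.2 % 2 ∧
    2 * (p.1 : ℝ) * (p.2 : ℝ) < x ^ 2 ∧ (p.2 : ℝ) < p.1 ∧
    (p.1 : ℝ) ≤ Real.exp (2 * θ) * p.2}.ncard

open MeasureTheory Topology Set
open scoped Pointwise

theorem tendsto_ncard_scaled_int {S : Set (ℝ × ℝ)} (hb : Bornology.IsBounded S)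
    (hm : MeasurableSet S) (hf : volume (frontier S) = 0)
    (hs : ∀ p ∈ S, ∀ t : ℝ, 0 < t → t ≤ 1 → t • p ∈ S) :
    Tendsto (fun x : ℝ => ({p : ℤ × ℤ | ((p.1 : ℝ) / x, (p.2 : ℝ) / x) ∈ S}.ncard : ℝ) / x ^ 2)
      atTop (𝓝 (volume.real S)) := by
  let e : (Fin 2 → ℝ) ≃ₜ ℝ × ℝ := Homeomorph.finTwoArrow
  have hpres : MeasurePreserving e := volume_preserving_finTwoArrow ℝ
  have hvol : volume.real (e ⁻¹' S) = volume.real S :=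
    hpres.measureReal_preimage hm.nullMeasurableSet
  have key := tendsto_card_div_pow_atTop_volume' (e ⁻¹' S) ?_ (hpres.measurable hm) ?_ ?_
  · rw [hvol] at key
    refine key.congr' ?_
    filter_upwards [eventually_gt_atTop 0] with x hx
    have himg : e ⁻¹' S ∩ x⁻¹ • (Submodule.span ℤ (Set.range (Pi.basisFun ℝ (Fin 2))) : Set (Fin 2 → ℝ))
        = (fun p : ℤ × ℤ => (![(p.1 : ℝ) / x, (p.2 : ℝ) / x] : Fin 2 → ℝ)) ''
          {p : ℤ × ℤ | ((p.1 : ℝ) / x, (p.2 : ℝ) / x) ∈ S} := by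
      ext v
      simp only [mem_inter_iff, mem_preimage, mem_inv_smul_set_iff₀ hx.ne', SetLike.mem_coe,
        Module.Basis.mem_span_iff_repr_mem, Pi.basisFun_repr, mem_image, mem_ofPred_eq, Prod.exists,
        Fin.forall_fin_two, Pi.smul_apply, smul_eq_mul, mem_range, algebraMap_int_eq, eq_intCast]
      constructor
      · rintro ⟨hv, ⟨a, ha⟩, ⟨b, hb⟩⟩
        have h0 : (a : ℝ) / x = v 0 := by rw [ha]; field_simp
        have h1 : (b : ℝ) / x = v 1 := by rw [hb]; field_simp
        refine ⟨a, b, ?_, ?_⟩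
        · rw [h0, h1]; exact hv
        · rw [h0, h1]; ext i; fin_cases i <;> rfl
      · rintro ⟨a, b, h, rfl⟩
        refine ⟨h, ⟨a, ?_⟩, ⟨b, ?_⟩⟩ <;> simp <;> field_simp
    rw [himg, Nat.card_coe_set_eq, Set.ncard_image_of_injective, Fintype.card_fin]
    rintro ⟨a, b⟩ ⟨c, d⟩ h
    have h0 := congrFun h 0
    have h1 := congrFun h 1
    simp only [Matrix.cons_val_zero, Matrix.cons_val_one] at h0 h1
    rw [div_left_inj' hx.ne'] at h0 h1
    exact Prod.ext (mod_cast h0) (mod_cast h1)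
  · obtain ⟨R, hR⟩ := hb.exists_norm_le
    refine isBounded_iff_forall_norm_le.mpr ⟨R, fun v hv => ?_⟩
    have h := hR _ hv
    have hR0 : 0 ≤ R := (norm_nonneg _).trans h
    rw [pi_norm_le_iff_of_nonneg hR0, Fin.forall_fin_two]
    exact ⟨(norm_fst_le _).trans h, (norm_snd_le _).trans h⟩
  · rw [← e.preimage_frontier, hpres.measure_preimage isClosed_frontier.nullMeasurableSet, hf]
  · intro x y hx hxy v hv
    have hy := hx.trans_le hxy
    rw [mem_smul_set_iff_inv_smul_mem₀ hx.ne'] at hv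
    rw [mem_smul_set_iff_inv_smul_mem₀ hy.ne']
    have h := hs _ hv (x / y) (by positivity) (by rw [div_le_one hy]; exact hxy)
    have : (x / y) • e (x⁻¹ • v) = e (y⁻¹ • v) := by
      ext <;> simp [e] <;> field_simp
    rw [this] at h
    exact h

theorem volume_preimage_linear_prod (a b c d k : ℝ) (hk : 0 < k) (h : |a * d - b * c| = k)
    (S : Set (ℝ × ℝ)) :
    volume.real ((fun p : ℝ × ℝ => (a * p.1 + b * p.2, c * p.1 + d * p.2)) ⁻¹' S) =
      volume.real S / k := by
  let f : ℝ × ℝ →ₗ[ℝ] ℝ × ℝ :=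
    Matrix.toLin (Module.Basis.finTwoProd ℝ) (Module.Basis.finTwoProd ℝ) !![a, b; c, d]
  have hdet : LinearMap.det f = a * d - b * c := by
    simp [f, LinearMap.det_toLin, Matrix.det_fin_two_of]
  have hf : ⇑f = fun p : ℝ × ℝ => (a * p.1 + b * p.2, c * p.1 + d * p.2) := by
    ext p <;> simp [f, Matrix.toLin_finTwoProd_apply]
  have h0 : LinearMap.det f ≠ 0 := by
    rw [hdet, ← abs_pos, h]; exact hk
  rw [← hf, measureReal_def, Measure.addHaar_preimage_linearMap _ h0, ENNReal.toReal_mul, hdet,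
    abs_inv, h, ENNReal.toReal_ofReal (by positivity), measureReal_def]
  ring

theorem tendsto_ncard_scaled_int_sameParity {S : Set (ℝ × ℝ)} (hb : Bornology.IsBounded S)
    (hm : MeasurableSet S) (hf : volume (frontier S) = 0)
    (hs : ∀ p ∈ S, ∀ t : ℝ, 0 < t → t ≤ 1 → t • p ∈ S) :
    Tendsto (fun x : ℝ => ({p : ℤ × ℤ | p.1 % 2 = p.2 % 2 ∧
      ((p.1 : ℝ) / x, (p.2 : ℝ) / x) ∈ S}.ncard : ℝ) / x ^ 2)
      atTop (𝓝 (volume.real S / 2)) := by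
  let T : ℝ × ℝ ≃ₜ ℝ × ℝ :=
    { toFun := fun p => (1 * p.1 + 1 * p.2, 1 * p.1 + (-1) * p.2)
      invFun := fun p => ((p.1 + p.2) / 2, (p.1 - p.2) / 2)
      left_inv := fun p => by ext <;> simp <;> ring
      right_inv := fun p => by ext <;> simp <;> ring
      continuous_toFun := by fun_prop
      continuous_invFun := by fun_prop }
  have hvol (A : Set (ℝ × ℝ)) : volume.real (T ⁻¹' A) = volume.real A / 2 :=
    volume_preimage_linear_prod 1 1 1 (-1) 2 (by norm_num) (by norm_num) A
  have hfin (A : Set (ℝ × ℝ)) (hA : Bornology.IsBounded A) : Bornology.IsBounded (T ⁻¹' A) := by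
    obtain ⟨R, hR⟩ := hA.exists_norm_le
    refine isBounded_iff_forall_norm_le.mpr ⟨R, fun v hv => ?_⟩
    have h := hR _ hv
    have h1 := abs_le.mp ((norm_fst_le _).trans h)
    have h2 := abs_le.mp ((norm_snd_le _).trans h)
    simp only [T, Homeomorph.homeomorph_mk_coe, Equiv.coe_fn_mk] at h1 h2
    refine max_le (abs_le.mpr ⟨?_, ?_⟩) (abs_le.mpr ⟨?_, ?_⟩) <;> linarith
  rw [← hvol]
  refine (tendsto_ncard_scaled_int (hfin S hb) (T.measurable hm) ?_ ?_).congr' ?_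
  · have hle : volume (frontier (T ⁻¹' S)) ≠ ⊤ :=
      ((measure_mono frontier_subset_closure).trans_lt
        (hfin S hb).closure.measure_lt_top).ne
    rw [← measureReal_eq_zero_iff hle, ← T.preimage_frontier, hvol, measureReal_def, hf]
    simp
  · intro p hp t ht0 ht1
    have := hs _ hp t ht0 ht1
    have h : t • T p = T (t • p) := by
      ext <;> simp [T] <;> ring
    rwa [h] at this
  · filter_upwards with x
    congr 2
    have himg : {p : ℤ × ℤ | p.1 % 2 = p.2 % 2 ∧ ((p.1 : ℝ) / x, (p.2 : ℝ) / x) ∈ S} =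
        (fun p : ℤ × ℤ => (p.1 + p.2, p.1 - p.2)) ''
          {p : ℤ × ℤ | ((p.1 : ℝ) / x, (p.2 : ℝ) / x) ∈ T ⁻¹' S} := by
      have hT (c d : ℤ) : T ((c : ℝ) / x, (d : ℝ) / x) =
          (((c + d : ℤ) : ℝ) / x, ((c - d : ℤ) : ℝ) / x) := by
        ext <;> simp [T] <;> ring
      ext ⟨a, b⟩
      simp only [mem_ofPred_eq, mem_image, Prod.exists, mem_preimage, hT, Prod.mk.injEq]
      constructor
      · rintro ⟨h1, h2⟩
        have ha : (a + b) / 2 + (a - b) / 2 = a := by omega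
        have hb : (a + b) / 2 - (a - b) / 2 = b := by omega
        exact ⟨(a + b) / 2, (a - b) / 2, by rwa [ha, hb], ha, hb⟩
      · rintro ⟨c, d, h, rfl, rfl⟩
        exact ⟨by omega, h⟩
    rw [himg, Set.ncard_image_of_injective]
    rintro ⟨a, b⟩ ⟨c, d⟩ h
    simp only [Prod.mk.injEq] at h ⊢
    omega

theorem scaled_nat_subset_Icc {S : Set (ℝ × ℝ)} {R : ℝ} (hb : S ⊆ Ioc 0 R ×ˢ Ioc 0 R) {x : ℝ}
    (hx : 0 < x) :
    {p : ℕ × ℕ | ((p.1 : ℝ) / x, (p.2 : ℝ) / x) ∈ S} ⊆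
      ↑(Finset.Icc 1 ⌊R * x⌋₊ ×ˢ Finset.Icc 1 ⌊R * x⌋₊) := by
  rintro ⟨a, b⟩ h
  obtain ⟨⟨ha, ha'⟩, hb, hb'⟩ := hb h
  simp only [div_le_iff₀ hx] at ha' hb'
  simp only [div_pos_iff_of_pos_right hx, Nat.cast_pos] at ha hb
  simp only [Finset.coe_product, Finset.coe_Icc, mem_prod, mem_Icc]
  exact ⟨⟨ha, Nat.le_floor ha'⟩, hb, Nat.le_floor hb'⟩

theorem tendsto_ncard_scaled_oppositeParity {S : Set (ℝ × ℝ)} {R : ℝ}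
    (hb : S ⊆ Ioc 0 R ×ˢ Ioc 0 R)
    (hm : MeasurableSet S) (hf : volume (frontier S) = 0)
    (hs : ∀ p ∈ S, ∀ t : ℝ, 0 < t → t ≤ 1 → t • p ∈ S) :
    Tendsto (fun x : ℝ => ({p : ℕ × ℕ | p.1 % 2 ≠ p.2 % 2 ∧
      ((p.1 : ℝ) / x, (p.2 : ℝ) / x) ∈ S}.ncard : ℝ) / x ^ 2)
      atTop (𝓝 (volume.real S / 2)) := by
  have hbd : Bornology.IsBounded S :=
    ((Metric.isBounded_Ioc 0 R).prod (Metric.isBounded_Ioc 0 R)).subset hb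
  have h := (tendsto_ncard_scaled_int hbd hm hf hs).sub
    (tendsto_ncard_scaled_int_sameParity hbd hm hf hs)
  rw [sub_half] at h
  refine h.congr' ?_
  filter_upwards [eventually_gt_atTop 0] with x hx
  let φ : ℕ × ℕ → ℤ × ℤ := fun p => (p.1, p.2)
  have hφ : Function.Injective φ := by
    rintro ⟨a, b⟩ ⟨c, d⟩ h
    simpa [φ] using h
  have hsub {A : Set (ℤ × ℤ)} (hA : A ⊆ {p | ((p.1 : ℝ) / x, (p.2 : ℝ) / x) ∈ S}) :
      A = φ '' (φ ⁻¹' A) := by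
    refine (image_preimage_eq_of_subset ?_).symm
    rintro ⟨a, b⟩ hab
    obtain ⟨⟨ha, -⟩, hb, -⟩ := hb (hA hab)
    simp only [div_pos_iff_of_pos_right hx, Int.cast_pos] at ha hb
    exact ⟨(a.toNat, b.toNat), Prod.ext (Int.toNat_of_nonneg ha.le) (Int.toNat_of_nonneg hb.le)⟩
  have hfin := (Finset.finite_toSet _).subset (scaled_nat_subset_Icc hb hx)
  rw [hsub Subset.rfl, hsub (A := {p | p.1 % 2 = p.2 % 2 ∧
    ((p.1 : ℝ) / x, (p.2 : ℝ) / x) ∈ S}) fun p hp => hp.2,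
    ncard_image_of_injective _ hφ, ncard_image_of_injective _ hφ, ← sub_div]
  congr 1
  rw [sub_eq_iff_eq_add, ← Nat.cast_add, Nat.cast_inj, ← ncard_union_eq ?_
    (hfin.subset fun p hp => hp.2) (hfin.subset fun p hp => by simpa [φ] using hp.2)]
  · congr 1
    ext ⟨a, b⟩
    simp only [φ, mem_preimage, mem_ofPred_eq, mem_union, Int.cast_natCast]
    have : ((a : ℤ) % 2 = b % 2) ↔ a % 2 = b % 2 := by omega
    tauto
  · rw [disjoint_left]
    rintro ⟨a, b⟩ h1 h2
    apply h1.1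
    have := h2.1
    simp only [φ] at this
    omega

open ArithmeticFunction ArithmeticFunction.Moebius in
theorem tsum_odd_moebius_div_sq :
    ∑' d : ℕ, (μ d : ℝ) * (if Odd d then 1 / (d : ℝ) ^ 2 else 0) = 8 / π ^ 2 := by
  have hs : (1 : ℝ) < (2 : ℂ).re := by norm_num
  have h1 := DirichletCharacter.LSeries.mul_mu_eq_one (1 : DirichletCharacter ℂ 2) hs
  have h2 : LSeries (fun n : ℕ => (1 : DirichletCharacter ℂ 2) n) 2 = (π : ℂ) ^ 2 / 8 := by
    rw [← DirichletCharacter.LFunction_eq_LSeries _ hs]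
    have := DirichletCharacter.LFunctionTrivChar_eq_mul_riemannZeta (N := 2) (s := 2) (by norm_num)
    rw [DirichletCharacter.LFunctionTrivChar] at this
    rw [this, riemannZeta_two, Nat.Prime.primeFactors Nat.prime_two, Finset.prod_singleton,
      Complex.cpow_neg, Nat.cast_ofNat, Complex.cpow_ofNat]
    ring
  rw [h2] at h1
  have hπ : (π : ℂ) ≠ 0 := by exact_mod_cast pi_ne_zero
  have h3 : LSeries ((fun n : ℕ => (1 : DirichletCharacter ℂ 2) n) * fun n : ℕ => ((μ n : ℤ) : ℂ)) 2
      = ((8 / π ^ 2 : ℝ) : ℂ) := by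
    push_cast
    field_simp
    linear_combination 8 * h1
  rw [LSeries] at h3
  have h4 (n : ℕ) : LSeries.term ((fun n : ℕ => (1 : DirichletCharacter ℂ 2) n) *
      fun n : ℕ => ((μ n : ℤ) : ℂ)) 2 n =
      (((μ n : ℝ) * (if Odd n then 1 / (n : ℝ) ^ 2 else 0) : ℝ) : ℂ) := by
    rcases eq_or_ne n 0 with rfl | hn
    · simp
    rw [LSeries.term_of_ne_zero hn, Pi.mul_apply, Complex.cpow_ofNat]
    split_ifs with h
    · rw [MulChar.one_apply ((ZMod.isUnit_iff_coprime n 2).mpr h.coprime_two_right)]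
      push_cast
      ring
    · rw [MulChar.map_nonunit]
      · simp
      · rwa [ZMod.isUnit_iff_coprime, Nat.coprime_two_right]
  simp_rw [h4] at h3
  rw [← Complex.ofReal_tsum] at h3
  exact_mod_cast h3

open ArithmeticFunction ArithmeticFunction.Moebius in
theorem ncard_coprime_eq_tsum {A : Set (ℕ × ℕ)} {M : ℕ}
    (hA : A ⊆ ↑(Finset.Icc 1 M ×ˢ Finset.Icc 1 M)) :
    ({p ∈ A | p.1.Coprime p.2}.ncard : ℝ) =
      ∑' d : ℕ, (μ d : ℝ) * ({p ∈ A | d ∣ p.1 ∧ d ∣ p.2}.ncard : ℝ) := by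
  classical
  obtain ⟨F, rfl⟩ := ((Finset.finite_toSet _).subset hA).exists_finset_coe
  have hmem {p : ℕ × ℕ} (hp : p ∈ F) : (1 ≤ p.1 ∧ p.1 ≤ M) ∧ 1 ≤ p.2 ∧ p.2 ≤ M := by
    simpa only [Finset.coe_product, Finset.coe_Icc, mem_prod, mem_Icc] using hA hp
  have hcard (q : ℕ × ℕ → Prop) [DecidablePred q] :
      ({p ∈ (F : Set (ℕ × ℕ)) | q p}.ncard : ℝ) = ∑ p ∈ F, if q p then 1 else 0 := by
    rw [← Finset.sum_filter, Finset.sum_const, nsmul_eq_mul, mul_one, ← ncard_coe_finset,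
      Finset.coe_filter]
    rfl
  rw [tsum_eq_sum (s := Finset.range (M + 1))]
  · simp_rw [hcard, Finset.mul_sum]
    rw [Finset.sum_comm]
    refine Finset.sum_congr rfl fun p hp => ?_
    have hp' := hmem hp
    have hg : p.1.gcd p.2 ≠ 0 := (Nat.gcd_pos_of_pos_left _ hp'.1.1).ne'
    have h := congrArg (fun f : ArithmeticFunction ℤ => f (p.1.gcd p.2)) moebius_mul_coe_zeta
    simp only [coe_mul_zeta_apply, one_apply] at h
    have h' : (if p.1.Coprime p.2 then (1 : ℝ) else 0) =
        ∑ d ∈ (p.1.gcd p.2).divisors, (μ d : ℝ) := by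
      rw [← Int.cast_sum, h]
      simp [Nat.Coprime]
    rw [h']
    simp_rw [mul_ite, mul_one, mul_zero]
    rw [← Finset.sum_filter]
    refine Finset.sum_congr ?_ fun _ _ => rfl
    ext d
    simp only [Nat.mem_divisors, Finset.mem_filter, Finset.mem_range, Nat.dvd_gcd_iff]
    constructor
    · rintro ⟨hd, -⟩
      exact ⟨Nat.lt_succ_of_le ((Nat.le_of_dvd hp'.1.1 hd.1).trans hp'.1.2), hd⟩
    · rintro ⟨-, hd⟩
      exact ⟨hd, hg⟩
  · intro d hd
    rw [Finset.mem_range, not_lt] at hd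
    rw [hcard, Finset.sum_eq_zero, mul_zero]
    intro p hp
    rw [if_neg]
    rintro ⟨h1, -⟩
    have := Nat.le_of_dvd (hmem hp).1.1 h1
    have := (hmem hp).1.2
    omega

theorem ncard_oppositeParity_dvd (S : Set (ℝ × ℝ)) (x : ℝ) {d : ℕ} (hd : d ≠ 0) :
    {p ∈ {p : ℕ × ℕ | p.1 % 2 ≠ p.2 % 2 ∧ ((p.1 : ℝ) / x, (p.2 : ℝ) / x) ∈ S} |
      d ∣ p.1 ∧ d ∣ p.2}.ncard = if Odd d then
        {p : ℕ × ℕ | p.1 % 2 ≠ p.2 % 2 ∧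
          ((p.1 : ℝ) / (x / d), (p.2 : ℝ) / (x / d)) ∈ S}.ncard else 0 := by
  have hdR : (d : ℝ) ≠ 0 := Nat.cast_ne_zero.mpr hd
  split_ifs with hodd
  · rw [← ncard_image_of_injective (f := fun p : ℕ × ℕ => (d * p.1, d * p.2))
      {p : ℕ × ℕ | p.1 % 2 ≠ p.2 % 2 ∧ ((p.1 : ℝ) / (x / d), (p.2 : ℝ) / (x / d)) ∈ S}]
    · congr 1
      have hpar (a b : ℕ) : (d * a) % 2 = (d * b) % 2 ↔ a % 2 = b % 2 :=
        ⟨Nat.ModEq.cancel_left_of_coprime (Nat.coprime_two_left.mpr hodd),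
          fun h => Nat.ModEq.mul_left d h⟩
      have hdiv (a : ℕ) : ((d * a : ℕ) : ℝ) / x = a / (x / d) := by
        push_cast
        rw [div_div_eq_mul_div, mul_comm]
      ext ⟨a, b⟩
      simp only [mem_ofPred_eq, mem_image, Prod.exists, Prod.mk.injEq]
      constructor
      · rintro ⟨⟨h1, h2⟩, ⟨a, rfl⟩, b, rfl⟩
        rw [hdiv, hdiv] at h2
        exact ⟨a, b, ⟨by rwa [Ne, ← hpar], h2⟩, rfl, rfl⟩
      · rintro ⟨a, b, ⟨h1, h2⟩, rfl, rfl⟩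
        rw [hdiv, hdiv]
        exact ⟨⟨by rwa [Ne, hpar], h2⟩, dvd_mul_right _ _, dvd_mul_right _ _⟩
    · rintro ⟨a, b⟩ ⟨c, e⟩ h
      simpa [hd] using h
  · rw [Nat.not_odd_iff_even, even_iff_two_dvd] at hodd
    convert ncard_empty (ℕ × ℕ)
    rw [eq_empty_iff_forall_notMem]
    rintro ⟨a, b⟩ ⟨⟨h, -⟩, ha, hb⟩
    have h1 := hodd.trans ha
    have h2 := hodd.trans hb
    simp only at h h1 h2
    omega

open ArithmeticFunction ArithmeticFunction.Moebius in
theorem tendsto_ncard_scaled_coprime {S : Set (ℝ × ℝ)} {R c : ℝ}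
    (hb : S ⊆ Ioc 0 R ×ˢ Ioc 0 R)
    (h : Tendsto (fun x : ℝ => ({p : ℕ × ℕ | p.1 % 2 ≠ p.2 % 2 ∧
      ((p.1 : ℝ) / x, (p.2 : ℝ) / x) ∈ S}.ncard : ℝ) / x ^ 2) atTop (𝓝 c)) :
    Tendsto (fun x : ℝ => ({p ∈ {p : ℕ × ℕ | p.1 % 2 ≠ p.2 % 2 ∧
      ((p.1 : ℝ) / x, (p.2 : ℝ) / x) ∈ S} | p.1.Coprime p.2}.ncard : ℝ) / x ^ 2) atTop
      (𝓝 (c * (8 / π ^ 2))) := by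
  set N : ℝ → ℕ := fun x => {p : ℕ × ℕ | p.1 % 2 ≠ p.2 % 2 ∧
      ((p.1 : ℝ) / x, (p.2 : ℝ) / x) ∈ S}.ncard
  rcases lt_or_ge R 0 with hR | hR
  · have hS : S = ∅ := by
      rw [Set.eq_empty_iff_forall_notMem]
      intro p hp
      have := (hb hp).1
      linarith [this.1, this.2]
    subst hS
    have hc : c = 0 := tendsto_nhds_unique h (by simp)
    simp [hc]
  have hbound {y : ℝ} (hy : 0 < y) : (N y : ℝ) / y ^ 2 ≤ R ^ 2 := by
    rw [div_le_iff₀ (by positivity), ← mul_pow]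
    have h1 : N y ≤ ⌊R * y⌋₊ * ⌊R * y⌋₊ := by
      have := ncard_le_ncard (s := {p : ℕ × ℕ | p.1 % 2 ≠ p.2 % 2 ∧
        ((p.1 : ℝ) / y, (p.2 : ℝ) / y) ∈ S})
        (fun p hp => scaled_nat_subset_Icc hb hy hp.2) (Finset.finite_toSet _)
      rwa [ncard_coe_finset, Finset.card_product, Nat.card_Icc, Nat.add_sub_cancel] at this
    have h2 : (⌊R * y⌋₊ : ℝ) ≤ R * y := Nat.floor_le (by positivity)
    calc (N y : ℝ) ≤ (⌊R * y⌋₊ : ℝ) * ⌊R * y⌋₊ := mod_cast h1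
      _ ≤ (R * y) * (R * y) := by gcongr
      _ = _ := by ring
  have hterm (x : ℝ) (d : ℕ) : (μ d : ℝ) * ({p ∈ {p : ℕ × ℕ | p.1 % 2 ≠ p.2 % 2 ∧
      ((p.1 : ℝ) / x, (p.2 : ℝ) / x) ∈ S} | d ∣ p.1 ∧ d ∣ p.2}.ncard : ℝ) / x ^ 2 =
      (μ d : ℝ) * (if Odd d then 1 / (d : ℝ) ^ 2 else 0) * (N (x / d) / (x / d) ^ 2) := by
    rcases eq_or_ne d 0 with rfl | hd
    · simp
    have hdR : (d : ℝ) ≠ 0 := Nat.cast_ne_zero.mpr hd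
    rw [ncard_oppositeParity_dvd S x hd]
    split_ifs
    · change _ * (N (x / d) : ℝ) / _ = _
      rw [div_pow]
      field_simp
    · simp
  have key : Tendsto (fun x : ℝ => ∑' d : ℕ,
      (μ d : ℝ) * (if Odd d then 1 / (d : ℝ) ^ 2 else 0) * (N (x / d) / (x / d) ^ 2)) atTop
      (𝓝 (∑' d : ℕ, (μ d : ℝ) * (if Odd d then 1 / (d : ℝ) ^ 2 else 0) * c)) := by
    refine tendsto_tsum_of_dominated_convergence (bound := fun d : ℕ => 1 / (d : ℝ) ^ 2 * R ^ 2)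
      ((summable_one_div_nat_pow.mpr one_lt_two).mul_right _) ?_ ?_
    · intro d
      rcases eq_or_ne d 0 with rfl | hd
      · simp
      have hdR : (0 : ℝ) < d := Nat.cast_pos.mpr (Nat.pos_of_ne_zero hd)
      exact (h.comp (tendsto_id.atTop_div_const hdR)).const_mul _
    · filter_upwards [eventually_gt_atTop 0] with x hx d
      rcases eq_or_ne d 0 with rfl | hd
      · simp
      have hdR : (0 : ℝ) < d := Nat.cast_pos.mpr (Nat.pos_of_ne_zero hd)
      have h1 : |(μ d : ℝ)| ≤ 1 := by
        exact_mod_cast abs_moebius_le_one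
      have h2 : |(if Odd d then 1 / (d : ℝ) ^ 2 else 0)| ≤ 1 / (d : ℝ) ^ 2 := by
        split_ifs
        · rw [abs_of_nonneg (by positivity)]
        · rw [abs_zero]; positivity
      rw [norm_mul, norm_mul, Real.norm_eq_abs, Real.norm_eq_abs, Real.norm_eq_abs,
        abs_of_nonneg (a := (N (x / d) : ℝ) / _) (by positivity)]
      calc _ ≤ 1 * (1 / (d : ℝ) ^ 2) * R ^ 2 := by
            gcongr
            exact hbound (by positivity)
        _ = _ := by ring
  rw [tsum_mul_right, tsum_odd_moebius_div_sq, mul_comm] at key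
  refine key.congr' ?_
  filter_upwards [eventually_gt_atTop 0] with x hx
  refine Eq.trans ?_ (congrArg (· / x ^ 2)
    (ncard_coprime_eq_tsum fun p hp => scaled_nat_subset_Icc hb hx hp.2).symm)
  rw [← tsum_div_const]
  exact tsum_congr fun d => (hterm x d).symm

/-- The hyperbolic sector `H_θ(1)`. -/
def hyperbolicSector (θ : ℝ) : Set (ℝ × ℝ) :=
  {p | 0 < p.1} ∩ {p | 0 < p.2} ∩ {p | p.1 ^ 2 - p.2 ^ 2 < 1} ∩ {p | p.2 ≤ tanh θ * p.1}

/-- The hyperbolic sector `H*_θ(1)`. -/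
def hyperbolicSectorStar (θ : ℝ) : Set (ℝ × ℝ) :=
  {p | 0 < p.1} ∩ {p | 0 < p.2} ∩ {p | 2 * p.1 * p.2 < 1} ∩ {p | p.2 < p.1} ∩
    {p | p.1 ≤ exp (2 * θ) * p.2}

theorem volume_setOf_eq_null {f g : ℝ × ℝ → ℝ} (hf : Continuous f) (hg : Continuous g)
    (h : ∀ x : ℝ, x ≠ 0 → {y : ℝ | f (x, y) = g (x, y)}.Countable) :
    volume {p | f p = g p} = 0 := by
  rw [Measure.volume_eq_prod, Measure.measure_prod_null (isClosed_eq hf hg).measurableSet]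
  filter_upwards [compl_mem_ae_iff.mpr (measure_singleton (0 : ℝ))] with x hx
  exact (h x hx).measure_zero _

theorem volume_frontier_lt_null {f g : ℝ × ℝ → ℝ} (hf : Continuous f) (hg : Continuous g)
    (h : ∀ x : ℝ, x ≠ 0 → {y : ℝ | f (x, y) = g (x, y)}.Countable) :
    volume (frontier {p | f p < g p}) = 0 :=
  measure_mono_null (frontier_lt_subset_eq hf hg) (volume_setOf_eq_null hf hg h)

theorem volume_frontier_le_null {f g : ℝ × ℝ → ℝ} (hf : Continuous f) (hg : Continuous g)
    (h : ∀ x : ℝ, x ≠ 0 → {y : ℝ | f (x, y) = g (x, y)}.Countable) :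
    volume (frontier {p | f p ≤ g p}) = 0 :=
  measure_mono_null (frontier_le_subset_eq hf hg) (volume_setOf_eq_null hf hg h)

theorem volume_frontier_inter_null {A B : Set (ℝ × ℝ)} (hA : volume (frontier A) = 0)
    (hB : volume (frontier B) = 0) : volume (frontier (A ∩ B)) = 0 :=
  measure_mono_null ((frontier_inter_subset A B).trans
    (union_subset_union inter_subset_left inter_subset_right)) (measure_union_null hA hB)

theorem volume_frontier_pos_quadrant :
    volume (frontier ({p : ℝ × ℝ | 0 < p.1} ∩ {p : ℝ × ℝ | 0 < p.2})) = 0 := by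
  refine volume_frontier_inter_null
    (volume_frontier_lt_null (by fun_prop) (by fun_prop) fun x hx => ?_)
    (volume_frontier_lt_null (by fun_prop) (by fun_prop) fun x hx => ?_)
  · simp [hx.symm]
  · exact (subsingleton_of_forall_eq 0 fun y hy => hy.symm).countable

theorem volume_frontier_hyperbolicSector (θ : ℝ) :
    volume (frontier (hyperbolicSector θ)) = 0 := by
  refine volume_frontier_inter_null (volume_frontier_inter_null volume_frontier_pos_quadrant
    (volume_frontier_lt_null (by fun_prop) (by fun_prop) fun x hx => ?_))
    (volume_frontier_le_null (by fun_prop) (by fun_prop) fun x hx => ?_)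
  · refine (Set.toFinite {√(x ^ 2 - 1), -√(x ^ 2 - 1)}).countable.mono fun y hy => ?_
    have hy : y ^ 2 = x ^ 2 - 1 := by
      have : x ^ 2 - y ^ 2 = 1 := hy
      linarith
    have := sq_eq_sq_iff_eq_or_eq_neg.mp ((Real.sq_sqrt (by rw [← hy]; positivity)).trans hy.symm)
    rcases this with h | h
    · exact Or.inl h.symm
    · right; simp [h]
  · exact (subsingleton_of_forall_eq (tanh θ * x) fun y hy => hy).countable

theorem volume_frontier_hyperbolicSectorStar (θ : ℝ) :
    volume (frontier (hyperbolicSectorStar θ)) = 0 := by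
  refine volume_frontier_inter_null (volume_frontier_inter_null (volume_frontier_inter_null
    volume_frontier_pos_quadrant
    (volume_frontier_lt_null (by fun_prop) (by fun_prop) fun x hx => ?_))
    (volume_frontier_lt_null (by fun_prop) (by fun_prop) fun x hx => ?_))
    (volume_frontier_le_null (by fun_prop) (by fun_prop) fun x hx => ?_)
  · refine (subsingleton_of_forall_eq (1 / (2 * x)) fun y hy => ?_).countable
    rw [eq_div_iff (by simpa using hx), mul_comm]
    exact hy
  · exact (subsingleton_of_forall_eq x fun y hy => hy).countable
  · refine (subsingleton_of_forall_eq (x / exp (2 * θ)) fun y hy => ?_).countable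
    rw [eq_div_iff (exp_ne_zero _), mul_comm]
    exact Eq.symm hy

theorem measurableSet_hyperbolicSector (θ : ℝ) : MeasurableSet (hyperbolicSector θ) :=
  (((measurableSet_lt (by fun_prop) (by fun_prop)).inter
    (measurableSet_lt (by fun_prop) (by fun_prop))).inter
    (measurableSet_lt (by fun_prop) (by fun_prop))).inter
    (measurableSet_le (by fun_prop) (by fun_prop))

theorem measurableSet_hyperbolicSectorStar (θ : ℝ) : MeasurableSet (hyperbolicSectorStar θ) :=
  ((((measurableSet_lt (by fun_prop) (by fun_prop)).inter
    (measurableSet_lt (by fun_prop) (by fun_prop))).inter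
    (measurableSet_lt (by fun_prop) (by fun_prop))).inter
    (measurableSet_lt (by fun_prop) (by fun_prop))).inter
    (measurableSet_le (by fun_prop) (by fun_prop))

theorem mem_hyperbolicSector {θ a b : ℝ} : (a, b) ∈ hyperbolicSector θ ↔
    0 < a ∧ 0 < b ∧ a ^ 2 - b ^ 2 < 1 ∧ b ≤ tanh θ * a := by
  simp [hyperbolicSector, and_assoc]

theorem mem_hyperbolicSectorStar {θ a b : ℝ} : (a, b) ∈ hyperbolicSectorStar θ ↔
    0 < a ∧ 0 < b ∧ 2 * a * b < 1 ∧ b < a ∧ a ≤ exp (2 * θ) * b := by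
  simp [hyperbolicSectorStar, and_assoc]

theorem hyperbolicSector_subset (θ : ℝ) :
    hyperbolicSector θ ⊆ Ioc 0 (cosh θ) ×ˢ Ioc 0 (cosh θ) := by
  rintro ⟨a, b⟩ h
  obtain ⟨ha, hb, h1, h2⟩ := mem_hyperbolicSector.mp h
  have hc := cosh_pos θ
  rw [tanh_eq_sinh_div_cosh, div_mul_eq_mul_div, le_div_iff₀ hc] at h2
  have h3 : (b * cosh θ) ^ 2 ≤ (sinh θ * a) ^ 2 := by gcongr
  have h4 := cosh_sq θ
  have h5 : a ^ 2 ≤ cosh θ ^ 2 := by nlinarith [sq_nonneg a, sq_nonneg b]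
  have h6 : b ^ 2 ≤ cosh θ ^ 2 := by nlinarith [sq_nonneg a, sq_nonneg b]
  exact ⟨⟨ha, (sq_le_sq₀ ha.le hc.le).mp h5⟩, hb, (sq_le_sq₀ hb.le hc.le).mp h6⟩

theorem hyperbolicSectorStar_subset (θ : ℝ) :
    hyperbolicSectorStar θ ⊆ Ioc 0 (1 + exp (2 * θ)) ×ˢ Ioc 0 (1 + exp (2 * θ)) := by
  rintro ⟨a, b⟩ h
  obtain ⟨ha, hb, h1, h2, h3⟩ := mem_hyperbolicSectorStar.mp h
  have hk := exp_pos (2 * θ)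
  have hb1 : b ≤ 1 := by nlinarith
  have ha1 : a ≤ exp (2 * θ) := by nlinarith
  exact ⟨⟨ha, by linarith⟩, hb, by linarith⟩

theorem smul_mem_hyperbolicSector {θ : ℝ} : ∀ p ∈ hyperbolicSector θ, ∀ t : ℝ, 0 < t → t ≤ 1 →
    t • p ∈ hyperbolicSector θ := by
  rintro ⟨a, b⟩ h t ht0 ht1
  obtain ⟨ha, hb, h1, h2⟩ := mem_hyperbolicSector.mp h
  have ht2 : t ^ 2 ≤ 1 := pow_le_one₀ ht0.le ht1
  refine mem_hyperbolicSector.mpr ⟨by simp; positivity, by simp; positivity, ?_, ?_⟩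
  · simp only [smul_eq_mul]
    nlinarith [sq_pos_of_pos ht0]
  · simp only [smul_eq_mul]
    nlinarith

theorem smul_mem_hyperbolicSectorStar {θ : ℝ} : ∀ p ∈ hyperbolicSectorStar θ, ∀ t : ℝ, 0 < t →
    t ≤ 1 → t • p ∈ hyperbolicSectorStar θ := by
  rintro ⟨a, b⟩ h t ht0 ht1
  obtain ⟨ha, hb, h1, h2, h3⟩ := mem_hyperbolicSectorStar.mp h
  have ht2 : t ^ 2 ≤ 1 := pow_le_one₀ ht0.le ht1
  refine mem_hyperbolicSectorStar.mpr ⟨by simp; positivity, by simp; positivity, ?_, ?_, ?_⟩ <;>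
    simp only [smul_eq_mul]
  · nlinarith [sq_pos_of_pos ht0]
  · gcongr
  · nlinarith

theorem volume_hyperbolicSector {θ : ℝ} (hθ : 0 < θ) :
    volume.real (hyperbolicSector θ) = θ / 2 := by
  have hs : 0 < sinh θ := sinh_pos_iff.mpr hθ
  have hc := cosh_pos θ
  have hcs := cosh_sq θ
  let g : ℝ → ℝ := fun y => √(1 + y ^ 2) - y * cosh θ / sinh θ
  have hg : Continuous g := by fun_prop
  have hg0 {y : ℝ} (hy : 0 < y) : 0 ≤ g y ↔ y ≤ sinh θ := by
    rw [sub_nonneg, Real.le_sqrt (by positivity), div_pow, div_le_iff₀ (by positivity),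
      ← sq_le_sq₀ hy.le hs.le, mul_pow, hcs]
    · constructor <;> intro h <;> linarith
    · positivity
  have hslice (y : ℝ) : volume ((fun x => (x, y)) ⁻¹' hyperbolicSector θ) =
      (Ioc 0 (sinh θ)).indicator (fun y => ENNReal.ofReal (g y)) y := by
    rcases le_or_gt y 0 with hy | hy
    · rw [indicator_of_notMem fun h => hy.not_gt h.1]
      convert measure_empty (μ := (volume : Measure ℝ))
      rw [eq_empty_iff_forall_notMem]
      exact fun x hx => hy.not_gt (mem_hyperbolicSector.mp hx).2.1
    · have hI : (fun x => (x, y)) ⁻¹' hyperbolicSector θ =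
          Ico (y * cosh θ / sinh θ) (√(1 + y ^ 2)) := by
        ext x
        rw [mem_preimage, mem_hyperbolicSector, mem_Ico, div_le_iff₀ hs, tanh_eq_sinh_div_cosh,
          div_mul_eq_mul_div, le_div_iff₀ hc, mul_comm x]
        have hpos (h : y * cosh θ ≤ sinh θ * x) : 0 < x :=
          pos_of_mul_pos_right ((mul_pos hy hc).trans_le h) hs.le
        constructor
        · rintro ⟨hx, -, h1, h2⟩
          exact ⟨h2, (Real.lt_sqrt hx.le).mpr (by linarith)⟩
        · rintro ⟨h1, h2⟩
          have hx := hpos h1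
          have := (Real.lt_sqrt hx.le).mp h2
          exact ⟨hx, hy, by linarith, h1⟩
      rw [hI, Real.volume_Ico]
      by_cases h : y ≤ sinh θ
      · rw [indicator_of_mem (mem_Ioc.mpr ⟨hy, h⟩)]
      · rw [indicator_of_notMem fun h' => h h'.2,
          ENNReal.ofReal_of_nonpos (not_le.mp (mt (hg0 hy).mp h)).le]
  have hvol : volume (hyperbolicSector θ) = ENNReal.ofReal (∫ y in Ioc 0 (sinh θ), g y) := by
    rw [Measure.volume_eq_prod, Measure.prod_apply_symm (measurableSet_hyperbolicSector θ)]
    simp_rw [hslice]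
    rw [lintegral_indicator measurableSet_Ioc, ofReal_integral_eq_lintegral_ofReal]
    · exact (hg.integrableOn_Icc).mono_set Ioc_subset_Icc_self
    · filter_upwards [ae_restrict_mem measurableSet_Ioc] with y hy
      exact (hg0 hy.1).mpr hy.2
  have hint : ∫ y in Ioc 0 (sinh θ), g y = θ / 2 := by
    rw [← intervalIntegral.integral_of_le hs.le]
    let F : ℝ → ℝ := fun y =>
      (y * √(1 + y ^ 2) + arsinh y) / 2 - y ^ 2 / 2 * (cosh θ / sinh θ)
    have hF (y : ℝ) : HasDerivAt F (g y) y := by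
      have hp : 0 < 1 + y ^ 2 := by positivity
      have h1 : HasDerivAt (fun y : ℝ => √(1 + y ^ 2)) (2 * y / (2 * √(1 + y ^ 2))) y :=
        HasDerivAt.sqrt (by simpa using (hasDerivAt_pow 2 y).const_add 1) hp.ne'
      have h2 := (((hasDerivAt_id y).mul h1).add (hasDerivAt_arsinh y)).div_const 2
      have h3 := (((hasDerivAt_pow 2 y).div_const 2).mul_const (cosh θ / sinh θ))
      refine HasDerivAt.congr_deriv (f := F) (h2.sub h3) ?_
      have h4 : √(1 + y ^ 2) ≠ 0 := (Real.sqrt_pos.mpr hp).ne'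
      have h5 := Real.sq_sqrt hp.le
      simp only [g, id_eq]
      field_simp
      push_cast
      rw [h5]
      linear_combination (-2 * sinh θ) * h5
    rw [intervalIntegral.integral_eq_sub_of_hasDerivAt (fun y _ => hF y)
      (hg.intervalIntegrable _ _)]
    have h1 : √(1 + sinh θ ^ 2) = cosh θ := by
      rw [add_comm, ← hcs, Real.sqrt_sq hc.le]
    simp only [F, h1, arsinh_sinh, arsinh_zero]
    field_simp
    ring
  rw [measureReal_def, hvol, hint, ENNReal.toReal_ofReal (by positivity)]

theorem volume_hyperbolicSectorStar {θ : ℝ} (hθ : 0 < θ) :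
    volume.real (hyperbolicSectorStar θ) = θ / 2 := by
  have h2 : (√2 : ℝ) ^ 2 = 2 := Real.sq_sqrt (by norm_num)
  have hinv : (1 / √2) * (1 / √2) = (1 / 2 : ℝ) := by
    field_simp
    linarith
  have hr : 0 < 1 / √(2 : ℝ) := by positivity
  generalize 1 / √(2 : ℝ) = r at hinv hr
  have key := volume_preimage_linear_prod r r r (-r) 1 one_pos
    (by rw [show r * -r - r * r = -1 by linarith]; simp) (hyperbolicSectorStar θ)
  rw [div_one] at key
  rw [← key, ← volume_hyperbolicSector hθ]
  congr 1
  ext ⟨a, b⟩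
  rw [mem_preimage, mem_hyperbolicSectorStar, mem_hyperbolicSector]
  have ht : b ≤ tanh θ * a ↔ r * a + r * b ≤ exp (2 * θ) * (r * a + -r * b) := by
    have he : exp (2 * θ) * exp (-θ) = exp θ := by rw [← exp_add]; congr 1; ring
    have h1 : r * a + r * b ≤ exp (2 * θ) * (r * a + -r * b) ↔
        a + b ≤ exp (2 * θ) * (a - b) := by
      rw [← mul_le_mul_iff_right₀ hr (b := a + b)]
      ring_nf
    rw [h1, ← mul_le_mul_iff_right₀ (exp_pos (-θ)) (b := a + b), tanh_eq, div_mul_eq_mul_div,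
      le_div_iff₀ (by positivity), show exp (-θ) * (exp (2 * θ) * (a - b)) = exp θ * (a - b) by
        rw [← he]; ring]
    constructor <;> intro h <;> linarith
  rw [← ht]
  have hsq : 2 * (r * a + r * b) * (r * a + -r * b) = a ^ 2 - b ^ 2 := by
    linear_combination 2 * (a ^ 2 - b ^ 2) * hinv
  rw [hsq]
  have htanh : tanh θ < 1 := by
    rw [tanh_eq_sinh_div_cosh, div_lt_one (cosh_pos θ)]
    exact sinh_lt_cosh θ
  constructor
  · rintro ⟨h1, h2, h3, h4, h5⟩
    have hb : 0 < b := by nlinarith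
    exact ⟨by nlinarith, hb, h3, h5⟩
  · rintro ⟨h1, h2, h3, h4⟩
    have hab : b < a := by nlinarith
    exact ⟨by positivity, by nlinarith, h3, by nlinarith, h4⟩

/-- Fix `0 < θ ≤ α`, where `α = artanh(√2 - 1) = log √(1 + √2)`. Then, as `x → ∞`,
`G_θ(x) ∼ θ·x²/4`, `G*_θ(x) ∼ θ·x²/4`, `g_θ(x) ∼ 2θ·x²/π²`, and `g*_θ(x) ∼ 2θ·x²/π²`. -/
theorem statement16 (θ : ℝ) (hθ : 0 < θ)
    (hθ' : θ ≤ Real.log (Real.sqrt (1 + Real.sqrt 2))) :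
    Tendsto (fun x : ℝ => (Gcount θ x : ℝ) / (θ * x ^ 2 / 4)) atTop (nhds 1) ∧
    Tendsto (fun x : ℝ => (GstarCount θ x : ℝ) / (θ * x ^ 2 / 4)) atTop (nhds 1) ∧
    Tendsto (fun x : ℝ => (gcount θ x : ℝ) / (2 * θ * x ^ 2 / π ^ 2)) atTop (nhds 1) ∧
    Tendsto (fun x : ℝ => (gstarCount θ x : ℝ) / (2 * θ * x ^ 2 / π ^ 2)) atTop (nhds 1) := by
  have hG := tendsto_ncard_scaled_oppositeParity (hyperbolicSector_subset θ)
    (measurableSet_hyperbolicSector θ) (volume_frontier_hyperbolicSector θ)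
    smul_mem_hyperbolicSector
  have hGs := tendsto_ncard_scaled_oppositeParity (hyperbolicSectorStar_subset θ)
    (measurableSet_hyperbolicSectorStar θ) (volume_frontier_hyperbolicSectorStar θ)
    smul_mem_hyperbolicSectorStar
  rw [volume_hyperbolicSector hθ] at hG
  rw [volume_hyperbolicSectorStar hθ] at hGs
  have hg := tendsto_ncard_scaled_coprime (hyperbolicSector_subset θ) hG
  have hgs := tendsto_ncard_scaled_coprime (hyperbolicSectorStar_subset θ) hGs
  have hS {x : ℝ} (hx : 0 < x) (a b : ℕ) : ((a : ℝ) / x, (b : ℝ) / x) ∈ hyperbolicSector θ ↔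
      0 < a ∧ 0 < b ∧ (a : ℝ) ^ 2 - (b : ℝ) ^ 2 < x ^ 2 ∧ (b : ℝ) ≤ tanh θ * a := by
    rw [mem_hyperbolicSector, div_pos_iff_of_pos_right hx, div_pos_iff_of_pos_right hx,
      Nat.cast_pos, Nat.cast_pos, div_pow, div_pow, ← sub_div, div_lt_one (by positivity),
      ← mul_div_assoc, div_le_div_iff_of_pos_right hx]
  have hSs {x : ℝ} (hx : 0 < x) (a b : ℕ) :
      ((a : ℝ) / x, (b : ℝ) / x) ∈ hyperbolicSectorStar θ ↔ 0 < a ∧ 0 < b ∧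
        2 * (a : ℝ) * (b : ℝ) < x ^ 2 ∧ (b : ℝ) < a ∧ (a : ℝ) ≤ exp (2 * θ) * b := by
    have h : 2 * ((a : ℝ) / x) * ((b : ℝ) / x) = 2 * a * b / x ^ 2 := by ring
    rw [mem_hyperbolicSectorStar, div_pos_iff_of_pos_right hx, div_pos_iff_of_pos_right hx,
      Nat.cast_pos, Nat.cast_pos, h, div_lt_one (by positivity), div_lt_div_iff_of_pos_right hx,
      ← mul_div_assoc, div_le_div_iff_of_pos_right hx]
  refine ⟨?_, ?_, ?_, ?_⟩
  · rw [← div_self (show θ / 2 / 2 ≠ 0 by positivity)]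
    refine (hG.div_const _).congr' ?_
    filter_upwards [eventually_gt_atTop 0] with x hx
    have : {p : ℕ × ℕ | p.1 % 2 ≠ p.2 % 2 ∧
        ((p.1 : ℝ) / x, (p.2 : ℝ) / x) ∈ hyperbolicSector θ}.ncard = Gcount θ x := by
      rw [Gcount]
      congr 1
      ext p
      simp only [mem_ofPred_eq, hS hx]
      tauto
    rw [this]
    field_simp
    norm_num
  · rw [← div_self (show θ / 2 / 2 ≠ 0 by positivity)]
    refine (hGs.div_const _).congr' ?_
    filter_upwards [eventually_gt_atTop 0] with x hx
    have : {p : ℕ × ℕ | p.1 % 2 ≠ p.2 % 2 ∧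
        ((p.1 : ℝ) / x, (p.2 : ℝ) / x) ∈ hyperbolicSectorStar θ}.ncard = GstarCount θ x := by
      rw [GstarCount]
      congr 1
      ext p
      simp only [mem_ofPred_eq, hSs hx]
      tauto
    rw [this]
    field_simp
    norm_num
  · rw [← div_self (show θ / 2 / 2 * (8 / π ^ 2) ≠ 0 by positivity)]
    refine (hg.div_const _).congr' ?_
    filter_upwards [eventually_gt_atTop 0] with x hx
    have : {p ∈ {p : ℕ × ℕ | p.1 % 2 ≠ p.2 % 2 ∧
        ((p.1 : ℝ) / x, (p.2 : ℝ) / x) ∈ hyperbolicSector θ} | p.1.Coprime p.2}.ncard =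
        gcount θ x := by
      rw [gcount]
      congr 1
      ext p
      simp only [mem_ofPred_eq, hS hx]
      tauto
    refine (congrArg (fun n : ℕ => (n : ℝ) / x ^ 2 / (θ / 2 / 2 * (8 / π ^ 2))) this).trans ?_
    field_simp
    norm_num
  · rw [← div_self (show θ / 2 / 2 * (8 / π ^ 2) ≠ 0 by positivity)]
    refine (hgs.div_const _).congr' ?_
    filter_upwards [eventually_gt_atTop 0] with x hx
    have : {p ∈ {p : ℕ × ℕ | p.1 % 2 ≠ p.2 % 2 ∧
        ((p.1 : ℝ) / x, (p.2 : ℝ) / x) ∈ hyperbolicSectorStar θ} | p.1.Coprime p.2}.ncard =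
        gstarCount θ x := by
      rw [gstarCount]
      congr 1
      ext p
      simp only [mem_ofPred_eq, hSs hx]
      tauto
    refine (congrArg (fun n : ℕ => (n : ℝ) / x ^ 2 / (θ / 2 / 2 * (8 / π ^ 2))) this).trans ?_
    field_simp
    norm_num
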